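/- arXiv:1609.06679 — 5 statements merged into one kernel-verified Lean document; each statement's English description precedes it below -/
import Mathlib

section
/- Let b>0 and let l≥−1/2 be real. If v:[0,b]→ℂ is twice continuously differentiable and v′(0)=0, then the function Y_l v is twice differentiable on (0,b) and satisfies (Y_l v)″(x) − (l(l+1)/x²)·(Y_l v)(x) = Y_l[v″](x) for every x∈(0,b). -/
open MeasureTheory Filter

/-- The operator Y_l acting on continuous functions on [0,b]. -/
noncomputable def Yl (l : ℝ) (v : ℝ → ℂ) (x : ℝ) : ℂ :=
  ((x ^ (-l) / (2 ^ (l + 1/2) * Real.Gamma (l + 3/2)) : ℝ) : ℂ) *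
    ∫ s in (0:ℝ)..x, (((x^2 - s^2) ^ l : ℝ) : ℂ) * v s

/-- Points `x * t` with `x ∈ (0,b)` and `t ∈ [0,1]` stay in `[0,b]`. -/
lemma mul_mem_Icc_of_mem_Ioo {b x t : ℝ} (hx : x ∈ Set.Ioo 0 b) (ht : t ∈ Set.Icc (0:ℝ) 1) :
    x * t ∈ Set.Icc 0 b :=
  ⟨mul_nonneg hx.1.le ht.1, (mul_le_of_le_one_right hx.1.le ht.2).trans hx.2.le⟩

lemma mul_mem_Ioo_of_mem_Ioo {b x t : ℝ} (hx : x ∈ Set.Ioo 0 b) (ht : t ∈ Set.Ioc (0:ℝ) 1) :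
    x * t ∈ Set.Ioo 0 b :=
  ⟨mul_pos hx.1 ht.1, (mul_le_of_le_one_right hx.1.le ht.2).trans_lt hx.2⟩

lemma continuousOn_comp_mul_left {b x : ℝ} {u : ℝ → ℂ} (hu : ContinuousOn u (Set.Icc 0 b))
    (hx : x ∈ Set.Ioo 0 b) : ContinuousOn (fun t => u (x * t)) (Set.Icc 0 1) :=
  hu.comp (by fun_prop) fun _ ht => mul_mem_Icc_of_mem_Ioo hx ht

lemma intervalIntegrable_mul_comp_mul_left {b x : ℝ} {u w : ℝ → ℂ}
    (hw : IntervalIntegrable w volume 0 1) (hu : ContinuousOn u (Set.Icc 0 b))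
    (hx : x ∈ Set.Ioo 0 b) :
    IntervalIntegrable (fun t => w t * u (x * t)) volume 0 1 :=
  hw.mul_continuousOn (by
    rw [Set.uIcc_of_le zero_le_one]
    exact continuousOn_comp_mul_left hu hx)

/-- Differentiation under the integral sign for a weighted average of dilates. -/
lemma hasDerivAt_integral_mul_comp_mul_left {b x : ℝ} {u u' w : ℝ → ℂ}
    (hw : IntervalIntegrable w volume 0 1) (hu : ContinuousOn u (Set.Icc 0 b))
    (hu' : ContinuousOn u' (Set.Icc 0 b)) (hd : ∀ y ∈ Set.Ioo 0 b, HasDerivAt u (u' y) y)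
    (hx : x ∈ Set.Ioo 0 b) :
    HasDerivAt (fun y => ∫ t in (0:ℝ)..1, w t * u (y * t))
      (∫ t in (0:ℝ)..1, w t * t * u' (x * t)) x := by
  obtain ⟨C, hC⟩ := isCompact_Icc.exists_bound_of_continuousOn hu'
  have hwt : IntervalIntegrable (fun t : ℝ => w t * (t : ℂ)) volume 0 1 :=
    hw.mul_continuousOn (by fun_prop)
  have hnhds : Set.Ioo 0 b ∈ nhds x := Ioo_mem_nhds hx.1 hx.2
  refine (intervalIntegral.hasDerivAt_integral_of_dominated_loc_of_deriv_le
    (F := fun y t => w t * u (y * t)) (F' := fun y t => w t * t * u' (y * t))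
    (bound := fun t => ‖w t * (t : ℂ)‖ * C) hnhds ?_
    (intervalIntegrable_mul_comp_mul_left hw hu hx) ?_ ?_ ?_ ?_).2
  · filter_upwards [hnhds] with y hy
    exact (intervalIntegrable_iff.1 (intervalIntegrable_mul_comp_mul_left hw hu hy)).1
  · exact (intervalIntegrable_iff.1 (intervalIntegrable_mul_comp_mul_left hwt hu' hx)).1
  · refine ae_of_all _ fun t ht y hy => ?_
    rw [Set.uIoc_of_le zero_le_one] at ht
    rw [norm_mul]
    gcongr
    exact hC _ (mul_mem_Icc_of_mem_Ioo hy (Set.Ioc_subset_Icc_self ht))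
  · exact hwt.norm.mul_const C
  · refine ae_of_all _ fun t ht y hy => ?_
    rw [Set.uIoc_of_le zero_le_one] at ht
    have h := (hd _ (mul_mem_Ioo_of_mem_Ioo hy ht)).scomp y ((hasDerivAt_id y).mul_const t)
    exact (h.const_mul (w t)).congr_deriv (by simp [mul_assoc])

lemma intervalIntegrable_one_sub_sq_rpow {l : ℝ} (hl : -1 < l) :
    IntervalIntegrable (fun t : ℝ => (((1 - t ^ 2) ^ l : ℝ) : ℂ)) volume 0 1 := by
  have h : IntervalIntegrable (fun t : ℝ => (1 - t) ^ l) volume 0 1 := by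
    simpa using ((intervalIntegral.intervalIntegrable_rpow' (a := 0) (b := 1) hl).comp_sub_left
      1).symm
  have hc : ContinuousOn (fun t : ℝ => (1 + t) ^ l) (Set.uIcc 0 1) := by
    rw [Set.uIcc_of_le zero_le_one]
    refine ContinuousOn.rpow_const (by fun_prop) fun t ht => Or.inl ?_
    linarith [ht.1]
  have hprod := h.mul_continuousOn hc
  rw [intervalIntegrable_iff] at hprod ⊢
  refine IntegrableOn.congr_fun hprod.ofReal (fun t ht => ?_) measurableSet_uIoc
  rw [Set.uIoc_of_le zero_le_one] at ht
  rw [← Real.mul_rpow (by linarith [ht.2]) (by linarith [ht.1])]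
  ring_nf
  rfl

/-- The rescaled form of `Yl`, with the integral over the fixed interval `[0,1]`. -/
lemma Yl_eq_mul_integral (l : ℝ) (u : ℝ → ℂ) {x : ℝ} (hx : 0 < x) :
    Yl l u x = (((2 ^ (l + 1/2) * Real.Gamma (l + 3/2))⁻¹ : ℝ) : ℂ) * (((x ^ (l + 1) : ℝ) : ℂ) *
      ∫ t in (0:ℝ)..1, (((1 - t ^ 2) ^ l : ℝ) : ℂ) * u (x * t)) := by
  have hsub := intervalIntegral.smul_integral_comp_mul_left (a := 0) (b := 1)
    (fun s : ℝ => (((x ^ 2 - s ^ 2) ^ l : ℝ) : ℂ) * u s) x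
  rw [mul_zero, mul_one] at hsub
  have hscale : ∫ t in (0:ℝ)..1, (((x ^ 2 - (x * t) ^ 2) ^ l : ℝ) : ℂ) * u (x * t) =
      (((x ^ l * x ^ l : ℝ)) : ℂ) *
        ∫ t in (0:ℝ)..1, (((1 - t ^ 2) ^ l : ℝ) : ℂ) * u (x * t) := by
    rw [← intervalIntegral.integral_const_mul]
    refine intervalIntegral.integral_congr fun t ht => ?_
    rw [Set.uIcc_of_le zero_le_one] at ht
    rw [← mul_assoc, ← Complex.ofReal_mul, ← Real.mul_rpow hx.le hx.le,
      ← Real.mul_rpow (by positivity) (by nlinarith [ht.1, ht.2])]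
    ring_nf
  have hpow : x ^ (-l) * (x * (x ^ l * x ^ l)) = x ^ (l + 1) := by
    rw [Real.rpow_neg hx.le, Real.rpow_add hx, Real.rpow_one]
    have := (Real.rpow_pos_of_pos hx l).ne'
    field_simp
  rw [Yl, ← hsub, hscale, ← hpow, Complex.real_smul]
  push_cast
  ring

/-- Integration by parts against `(1 - t²)^(l+1)`. -/
lemma integral_mul_deriv_eq_of_eq_zero {b l x : ℝ} {u u' : ℝ → ℂ} (hl : -1 < l)
    (hu : ContinuousOn u (Set.Icc 0 b)) (hu' : ContinuousOn u' (Set.Icc 0 b))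
    (hd : ∀ y ∈ Set.Ioo 0 b, HasDerivAt u (u' y) y) (hu0 : u 0 = 0) (hx : x ∈ Set.Ioo 0 b) :
    2 * ((l : ℂ) + 1) * (∫ t in (0:ℝ)..1, (((1 - t ^ 2) ^ l : ℝ) : ℂ) * t * u (x * t)) +
        x * (∫ t in (0:ℝ)..1, (((1 - t ^ 2) ^ l : ℝ) : ℂ) * t * t * u' (x * t)) =
      x * ∫ t in (0:ℝ)..1, (((1 - t ^ 2) ^ l : ℝ) : ℂ) * u' (x * t) := by
  have hw := intervalIntegrable_one_sub_sq_rpow hl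
  have hwt : IntervalIntegrable (fun t : ℝ => (((1 - t ^ 2) ^ l : ℝ) : ℂ) * (t : ℂ)) volume 0 1 :=
    hw.mul_continuousOn (by fun_prop)
  have hwtt : IntervalIntegrable (fun t : ℝ => (((1 - t ^ 2) ^ l : ℝ) : ℂ) * (t : ℂ) * (t : ℂ))
      volume 0 1 := hwt.mul_continuousOn (by fun_prop)
  have h₁ := (intervalIntegrable_mul_comp_mul_left hwt hu hx).const_mul (2 * ((l : ℂ) + 1))
  have h₂ := (intervalIntegrable_mul_comp_mul_left hwtt hu' hx).const_mul (x : ℂ)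
  have h₃ := (intervalIntegrable_mul_comp_mul_left hw hu' hx).const_mul (x : ℂ)
  have hcont : ContinuousOn (fun t : ℝ => (((1 - t ^ 2) ^ (l + 1) : ℝ) : ℂ) * u (x * t))
      (Set.Icc 0 1) := by
    refine ContinuousOn.mul ?_ (continuousOn_comp_mul_left hu hx)
    refine Complex.continuous_ofReal.comp_continuousOn ?_
    exact ContinuousOn.rpow_const (by fun_prop) fun t _ => Or.inr (by linarith)
  have hFTC := intervalIntegral.integral_eq_sub_of_hasDerivAt_of_le zero_le_one hcont
    (f' := fun t : ℝ => x * ((((1 - t ^ 2) ^ l : ℝ) : ℂ) * u' (x * t)) -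
      (2 * ((l : ℂ) + 1) * ((((1 - t ^ 2) ^ l : ℝ) : ℂ) * t * u (x * t)) +
        x * ((((1 - t ^ 2) ^ l : ℝ) : ℂ) * t * t * u' (x * t)))) (fun t ht => ?_)
    (h₃.sub (h₁.add h₂))
  · rw [intervalIntegral.integral_sub h₃ (h₁.add h₂), intervalIntegral.integral_add h₁ h₂] at hFTC
    simp only [intervalIntegral.integral_const_mul] at hFTC
    have h0 : (0 : ℝ) ^ (l + 1) = 0 := Real.zero_rpow (by linarith)
    simp only [one_pow, sub_self, h0, mul_zero, hu0, Complex.ofReal_zero, zero_mul] at hFTC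
    exact (sub_eq_zero.1 hFTC).symm
  · have hpos : 0 < 1 - t ^ 2 := by nlinarith [ht.1, ht.2]
    have hW : HasDerivAt (fun t : ℝ => (1 - t ^ 2) ^ (l + 1))
        (-(2 * t) * (l + 1) * (1 - t ^ 2) ^ l) t := by
      have := (((hasDerivAt_id t).pow 2).const_sub 1).rpow_const (p := l + 1) (Or.inl hpos.ne')
      simpa using this
    have hU := (hd _ (mul_mem_Ioo_of_mem_Ioo hx ⟨ht.1, ht.2.le⟩)).scomp t
      ((hasDerivAt_id t).const_mul x)
    refine (hW.ofReal_comp.mul hU).congr_deriv ?_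
    rw [Real.rpow_add_one hpos.ne']
    simp only [mul_one, Complex.real_smul, Function.comp_apply]
    push_cast
    ring

/-- if `v` is C² on `[0,b]` with `v'(0)=0`, then `Y_l v` is twice
differentiable on `(0,b)` and `(Y_l v)'' - (l(l+1)/x²) Y_l v = Y_l v''`. -/
theorem stmt0 (b l : ℝ) (hb : 0 < b) (hl : -(1/2) ≤ l) (v : ℝ → ℂ)
    (hv : ContDiffOn ℝ 2 v (Set.Icc 0 b))
    (hv0 : derivWithin v (Set.Icc 0 b) 0 = 0) :
    ∀ x ∈ Set.Ioo (0:ℝ) b,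
      DifferentiableAt ℝ (Yl l v) x ∧
      DifferentiableAt ℝ (deriv (Yl l v)) x ∧
      deriv (deriv (Yl l v)) x - ((l*(l+1)/x^2 : ℝ) : ℂ) * Yl l v x
        = Yl l (iteratedDerivWithin 2 v (Set.Icc 0 b)) x := by
  intro x hx
  have hU := uniqueDiffOn_Icc hb
  have hl1 : -1 < l := by linarith
  set v₁ := derivWithin v (Set.Icc 0 b)
  have hC₁ : ContDiffOn ℝ 1 v₁ (Set.Icc 0 b) := hv.derivWithin hU (by norm_num)
  have hv₂ : iteratedDerivWithin 2 v (Set.Icc 0 b) = derivWithin v₁ (Set.Icc 0 b) := by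
    rw [iteratedDerivWithin_succ, iteratedDerivWithin_one]
  rw [hv₂]
  set v₂ := derivWithin v₁ (Set.Icc 0 b)
  have hc₂ : ContinuousOn v₂ (Set.Icc 0 b) := hC₁.continuousOn_derivWithin hU le_rfl
  have hd₁ : ∀ y ∈ Set.Ioo 0 b, HasDerivAt v (v₁ y) y := fun y hy =>
    ((hv.differentiableOn (by norm_num)) y (Set.Ioo_subset_Icc_self hy)).hasDerivWithinAt.hasDerivAt
      (Icc_mem_nhds hy.1 hy.2)
  have hd₂ : ∀ y ∈ Set.Ioo 0 b, HasDerivAt v₁ (v₂ y) y := fun y hy =>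
    ((hC₁.differentiableOn (by norm_num)) y
      (Set.Ioo_subset_Icc_self hy)).hasDerivWithinAt.hasDerivAt (Icc_mem_nhds hy.1 hy.2)
  have hw := intervalIntegrable_one_sub_sq_rpow hl1
  have hwt : IntervalIntegrable (fun t : ℝ => (((1 - t ^ 2) ^ l : ℝ) : ℂ) * (t : ℂ)) volume 0 1 :=
    hw.mul_continuousOn (by fun_prop)
  have hF := fun y (hy : y ∈ Set.Ioo 0 b) =>
    hasDerivAt_integral_mul_comp_mul_left hw hv.continuousOn hC₁.continuousOn hd₁ hy
  have hF₁ := hasDerivAt_integral_mul_comp_mul_left hwt hC₁.continuousOn hc₂ hd₂ hx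
  have hparts := integral_mul_deriv_eq_of_eq_zero hl1 hC₁.continuousOn hc₂ hd₂ hv0 hx
  have hpow : ∀ p : ℝ, ∀ y ∈ Set.Ioo 0 b,
      HasDerivAt (fun y : ℝ => ((y ^ p : ℝ) : ℂ)) ((p * y ^ (p - 1) : ℝ) : ℂ) y := fun p y hy =>
    (Real.hasDerivAt_rpow_const (Or.inl hy.1.ne')).ofReal_comp
  set c : ℂ := (((2 ^ (l + 1/2) * Real.Gamma (l + 3/2))⁻¹ : ℝ) : ℂ) with hc
  have hY : ∀ y ∈ Set.Ioo 0 b, HasDerivAt (Yl l v) _ y := fun y hy =>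
    (((hpow (l + 1) y hy).mul (hF y hy)).const_mul c).congr_of_eventuallyEq (by
      filter_upwards [Ioo_mem_nhds hy.1 hy.2] with z hz
      exact Yl_eq_mul_integral l v hz.1)
  have hY₂ : HasDerivAt (deriv (Yl l v)) _ x :=
    (((((hpow (l + 1 - 1) x hx).const_mul ((l + 1 : ℝ) : ℂ)).mul (hF x hx)).add
      ((hpow (l + 1) x hx).mul hF₁)).const_mul c).congr_of_eventuallyEq (by
      filter_upwards [Ioo_mem_nhds hx.1 hx.2] with z hz
      rw [(hY z hz).deriv]
      simp)
  refine ⟨(hY x hx).differentiableAt, hY₂.differentiableAt, ?_⟩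
  rw [hY₂.deriv, Yl_eq_mul_integral l v hx.1, Yl_eq_mul_integral l v₂ hx.1, ← hc]
  have hx0 : (x : ℂ) ≠ 0 := Complex.ofReal_ne_zero.2 hx.1.ne'
  rw [add_sub_cancel_right, Real.rpow_add_one hx.1.ne', Real.rpow_sub_one hx.1.ne']
  push_cast
  have hcancel : (l : ℂ) * (l + 1) / (x : ℂ) ^ 2 * (((x ^ l : ℝ) : ℂ) * x) =
      (l + 1) * (l * (((x ^ l : ℝ) : ℂ) / x)) := by
    field_simp
  linear_combination c * ((x ^ l : ℝ) : ℂ) * hparts -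
    c * (∫ t in (0:ℝ)..1, (((1 - t ^ 2) ^ l : ℝ) : ℂ) * v (x * t)) * hcancel
end

section
/- For every real l≥−1/2, every ω>0 and every x>0: (x^{−l}/(2^{l+1/2} Γ(l+3/2))) ∫_0^x (x²−s²)^l cos(ωs) ds = (√π Γ(l+1)/(2 ω^{l+1} Γ(l+3/2))) · √(ωx) · J_{l+1/2}(ωx). -/
open MeasureTheory Filter

/-- The Bessel function of the first kind of real order ν (for positive argument). -/
noncomputable def besselJ (ν : ℝ) (z : ℝ) : ℝ :=
  ∑' k : ℕ, (-1:ℝ)^k * (z/2) ^ (ν + 2*(k:ℝ)) / ((Nat.factorial k) * Real.Gamma (ν + (k:ℝ) + 1))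

theorem integral_rpow_mul_sub_rpow {a u v : ℝ} (ha : 0 < a) (hu : 0 < u) (hv : 0 < v) :
    ∫ t in (0:ℝ)..a, t ^ (u - 1) * (a - t) ^ (v - 1) =
      a ^ (u + v - 1) * (Real.Gamma u * Real.Gamma v / Real.Gamma (u + v)) := by
  have h := Complex.betaIntegral_scaled u v ha
  rw [Complex.betaIntegral_eq_Gamma_mul_div _ _ (by simpa) (by simpa)] at h
  rw [← Complex.ofReal_inj, ← intervalIntegral.integral_ofReal]
  push_cast [Complex.ofReal_cpow ha.le]
  rw [← Complex.Gamma_ofReal, ← Complex.Gamma_ofReal, ← Complex.Gamma_ofReal]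
  push_cast
  rw [← h]
  refine intervalIntegral.integral_congr fun t ht => ?_
  rw [Set.uIcc_of_le ha.le] at ht
  rw [Complex.ofReal_cpow ht.1, Complex.ofReal_cpow (sub_nonneg.2 ht.2)]
  push_cast
  rfl

theorem integral_sq_sub_sq_rpow_mul_pow {l x : ℝ} (hl : -1 < l) (hx : 0 < x) (k : ℕ) :
    ∫ s in (0:ℝ)..x, (x ^ 2 - s ^ 2) ^ l * s ^ (2 * k) =
      (x ^ 2) ^ (k + l + 1 / 2) / 2 *
        (Real.Gamma (k + 1 / 2) * Real.Gamma (l + 1) / Real.Gamma (k + l + 3 / 2)) := by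
  have himg : (fun s : ℝ => s ^ 2) '' Set.Ioo 0 x = Set.Ioo 0 (x ^ 2) := by
    ext t
    constructor
    · rintro ⟨s, hs, rfl⟩
      exact ⟨pow_pos hs.1 2, pow_lt_pow_left₀ hs.2 hs.1.le two_ne_zero⟩
    · rintro ⟨h0, h1⟩
      exact ⟨√t, ⟨Real.sqrt_pos.2 h0, (Real.sqrt_lt' hx).2 h1⟩, Real.sq_sqrt h0.le⟩
  have hsub := integral_image_eq_integral_abs_deriv_smul (s := Set.Ioo 0 x)
    (f := fun s : ℝ => s ^ 2) (f' := fun s => 2 * s) measurableSet_Ioo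
    (fun s _ => by simpa using (hasDerivAt_pow 2 s).hasDerivWithinAt)
    (fun s hs t ht h => (pow_left_inj₀ hs.1.le ht.1.le two_ne_zero).1 h)
    (fun t => t ^ ((k + 1 / 2 : ℝ) - 1) * (x ^ 2 - t) ^ ((l + 1) - 1))
  rw [himg, ← integral_Ioc_eq_integral_Ioo, ← intervalIntegral.integral_of_le (by positivity),
    integral_rpow_mul_sub_rpow (by positivity) (by positivity) (by linarith)] at hsub
  have hcongr : ∀ s ∈ Set.Ioo 0 x,
      |2 * s| • ((s ^ 2) ^ ((k + 1 / 2 : ℝ) - 1) * (x ^ 2 - s ^ 2) ^ ((l + 1) - 1)) =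
        2 * ((x ^ 2 - s ^ 2) ^ l * s ^ (2 * k)) := by
    intro s hs
    have hs0 : 0 < s := hs.1
    have hpow : s * (s ^ 2) ^ ((k + 1 / 2 : ℝ) - 1) = s ^ (2 * k) := by
      nth_rewrite 1 [← Real.rpow_one s]
      rw [← Real.rpow_natCast s 2, ← Real.rpow_mul hs0.le, ← Real.rpow_add hs0,
        ← Real.rpow_natCast]
      congr 1
      push_cast
      ring
    rw [abs_of_pos (by positivity), smul_eq_mul, ← hpow, add_sub_cancel_right]
    ring
  rw [setIntegral_congr_fun measurableSet_Ioo hcongr, integral_const_mul,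
    ← integral_Ioc_eq_integral_Ioo, ← intervalIntegral.integral_of_le hx.le] at hsub
  rw [show (k + l + 1 / 2 : ℝ) = k + 1 / 2 + (l + 1) - 1 by ring,
    show (k + l + 3 / 2 : ℝ) = k + 1 / 2 + (l + 1) by ring]
  linarith

theorem intervalIntegrable_sq_sub_sq_rpow {l x : ℝ} (hl : -1 < l) (hx : 0 < x) :
    IntervalIntegrable (fun s : ℝ => (x ^ 2 - s ^ 2) ^ l) volume 0 x := by
  have h1 : IntervalIntegrable (fun s : ℝ => (x - s) ^ l) volume 0 x := by
    simpa using ((intervalIntegral.intervalIntegrable_rpow' hl (a := 0) (b := x)).comp_sub_left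
      x).symm
  have h2 : ContinuousOn (fun s : ℝ => (x + s) ^ l) (Set.uIcc 0 x) := by
    rw [Set.uIcc_of_le hx.le]
    exact ContinuousOn.rpow_const (by fun_prop) fun s hs => Or.inl (by linarith [hs.1])
  refine (h1.mul_continuousOn h2).congr fun s hs => ?_
  rw [Set.uIoc_of_le hx.le] at hs
  rw [← Real.mul_rpow (by linarith [hs.2]) (by linarith [hs.1])]
  congr 1
  ring

theorem hasSum_integral_sq_sub_sq_rpow_mul_cos {l x : ℝ} (hl : -1 < l) (hx : 0 < x) (ω : ℝ) :
    HasSum (fun k : ℕ => (-1) ^ k * ω ^ (2 * k) / (2 * k).factorial *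
        ∫ s in (0:ℝ)..x, (x ^ 2 - s ^ 2) ^ l * s ^ (2 * k))
      (∫ s in (0:ℝ)..x, (x ^ 2 - s ^ 2) ^ l * Real.cos (ω * s)) := by
  have hint := intervalIntegrable_sq_sub_sq_rpow hl hx
  have hsum : Summable fun k : ℕ => (|ω| * x) ^ (2 * k) / (2 * k).factorial :=
    (Real.hasSum_cosh (|ω| * x)).summable
  simp_rw [← intervalIntegral.integral_const_mul]
  refine intervalIntegral.hasSum_integral_of_dominated_convergence
    (fun k s => (x ^ 2 - s ^ 2) ^ l * ((|ω| * x) ^ (2 * k) / (2 * k).factorial))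
    (fun k => ?_) (fun k => ?_) ?_ ?_ ?_
  · have hcont : ContinuousOn (fun s : ℝ => s ^ (2 * k)) (Set.uIcc 0 x) := by fun_prop
    exact ((hint.mul_continuousOn hcont).const_mul _).def'.aestronglyMeasurable
  · refine Eventually.of_forall fun s hs => ?_
    rw [Set.uIoc_of_le hx.le] at hs
    have hb : 0 ≤ (x ^ 2 - s ^ 2) ^ l := Real.rpow_nonneg (by nlinarith [hs.1, hs.2]) _
    have hs0 : 0 ≤ s := hs.1.le
    rw [mul_left_comm, norm_mul, Real.norm_of_nonneg hb]
    refine mul_le_mul_of_nonneg_left ?_ hb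
    rw [mul_comm, mul_div_assoc', norm_div, norm_mul, norm_mul, norm_pow, norm_pow, norm_pow,
      norm_neg, norm_one, one_pow, one_mul, Real.norm_natCast, Real.norm_of_nonneg hs0,
      Real.norm_eq_abs, mul_comm, ← mul_pow]
    gcongr
    exact hs.2
  · exact Eventually.of_forall fun s _ => hsum.mul_left _
  · simp_rw [tsum_mul_left]
    exact hint.mul_const _
  · refine Eventually.of_forall fun s _ => ?_
    refine ((Real.hasSum_cos (ω * s)).mul_left ((x ^ 2 - s ^ 2) ^ l)).congr_fun fun k => ?_
    rw [mul_pow]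
    ring

theorem Gamma_nat_add_half_div_factorial (k : ℕ) :
    Real.Gamma (k + 1 / 2) / (2 * k).factorial = √Real.pi / (4 ^ k * k.factorial) := by
  have h := Real.Gamma_mul_Gamma_add_half (k + 1 / 2)
  rw [show (k + 1 / 2 + 1 / 2 : ℝ) = k + 1 by ring, Real.Gamma_nat_eq_factorial,
    show (2 * (k + 1 / 2) : ℝ) = (2 * k : ℕ) + 1 by push_cast; ring,
    Real.Gamma_nat_eq_factorial, show (1 - ((2 * k : ℕ) + 1) : ℝ) = -(2 * k : ℕ) by ring,
    Real.rpow_neg zero_le_two, Real.rpow_natCast, pow_mul] at h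
  norm_num at h
  rw [div_eq_div_iff (by positivity) (by positivity), mul_left_comm, h]
  field_simp

theorem rpow_bessel_coefficient (l : ℝ) {ω x : ℝ} (hω : 0 < ω) (hx : 0 < x) (k : ℕ) :
    x ^ (-l) / 2 ^ (l + 1 / 2) * (ω ^ (2 * k) * (x ^ 2) ^ (k + l + 1 / 2) / 4 ^ k) =
      √(ω * x) * (ω * x / 2) ^ (l + 1 / 2 + 2 * (k : ℝ)) / ω ^ (l + 1) := by
  have h4 : (4:ℝ) ^ k = 2 ^ (2 * (k:ℝ)) := by
    rw [Real.rpow_mul zero_le_two, Real.rpow_natCast]; norm_num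
  have hωk : ω ^ (2 * k) = ω ^ (2 * (k:ℝ)) := by
    rw [← Real.rpow_natCast]; push_cast; rfl
  have hx2 : (x ^ 2) ^ (k + l + 1 / 2) = x ^ (2 * (k + l + 1 / 2)) := by
    rw [Real.rpow_mul hx.le, Real.rpow_two]
  rw [h4, hωk, hx2, Real.sqrt_eq_rpow]
  have hz : 0 < ω * x / 2 := by positivity
  simp only [Real.rpow_def_of_pos, hω, hx, hz, mul_pos, zero_lt_two, ← Real.exp_add,
    ← Real.exp_sub]
  rw [Real.log_div (by positivity) (by positivity), Real.log_mul hω.ne' hx.ne']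
  congr 1
  ring

/-- the action of the operator Y_l on `cos(ω·)`. -/
theorem stmt2 (l : ℝ) (hl : -(1/2) ≤ l) (ω x : ℝ) (hω : 0 < ω) (hx : 0 < x) :
    (x ^ (-l) / (2 ^ (l + 1/2) * Real.Gamma (l + 3/2))) *
      ∫ s in (0:ℝ)..x, (x^2 - s^2) ^ l * Real.cos (ω * s)
    = (Real.sqrt Real.pi * Real.Gamma (l + 1) /
        (2 * ω ^ (l + 1) * Real.Gamma (l + 3/2))) *
      (Real.sqrt (ω * x) * besselJ (l + 1/2) (ω * x)) := by
  have hl' : -1 < l := by linarith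
  rw [besselJ, ← (hasSum_integral_sq_sub_sq_rpow_mul_cos hl' hx ω).tsum_eq, ← tsum_mul_left,
    ← tsum_mul_left, ← tsum_mul_left]
  refine tsum_congr fun k => ?_
  rw [integral_sq_sub_sq_rpow_mul_pow hl' hx]
  rw [show (l + 1 / 2 + k + 1 : ℝ) = k + l + 3 / 2 by ring]
  calc
    _ = (-1) ^ k * (x ^ (-l) / 2 ^ (l + 1 / 2) *
          (ω ^ (2 * k) * (x ^ 2) ^ (k + l + 1 / 2) / 4 ^ k)) * 4 ^ k *
        (Real.Gamma (k + 1 / 2) / (2 * k).factorial) *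
        (Real.Gamma (l + 1) / (2 * Real.Gamma (l + 3 / 2) * Real.Gamma (k + l + 3 / 2))) := by
      field_simp
    _ = _ := by
      rw [rpow_bessel_coefficient l hω hx, Gamma_nat_add_half_div_factorial]
      field_simp
end

section
/- For every real l≥−1/2 and every ω>0, the function v(x) = √(ωx) · J_{l+1/2}(ωx) is twice differentiable on (0,∞) and satisfies v″(x) − (l(l+1)/x²) v(x) = −ω² v(x) for all x>0. -/
open MeasureTheory Filter

/-- The entire function `∑ (-1)^k t^k / (k! Γ(ν+k+1))`, for which
`J_ν(z) = (z/2)^ν · besselEntire ν (z²/4)`. -/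
noncomputable def besselEntire (ν t : ℝ) : ℝ :=
  ∑' k : ℕ, (-1 : ℝ) ^ k / (k.factorial * Real.Gamma (ν + k + 1)) * t ^ k

lemma Gamma_add_one_le_Gamma_add_nat {ν : ℝ} (hν : 0 ≤ ν) (k : ℕ) :
    Real.Gamma (ν + 1) ≤ Real.Gamma (ν + k + 1) := by
  induction k with
  | zero => simp
  | succ k ih =>
    have hpos : 0 < ν + k + 1 := by positivity
    have h : ν + ((k + 1 : ℕ) : ℝ) + 1 = (ν + k + 1) + 1 := by push_cast; ring
    rw [h, Real.Gamma_add_one hpos.ne']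
    have hG := Real.Gamma_pos_of_pos hpos
    have hk : (0 : ℝ) ≤ ν + k := by positivity
    nlinarith [mul_nonneg hk hG.le]

lemma abs_besselEntire_coeff_le {ν : ℝ} (hν : 0 ≤ ν) (k : ℕ) :
    |(-1 : ℝ) ^ k / (k.factorial * Real.Gamma (ν + k + 1))|
      ≤ (Real.Gamma (ν + 1))⁻¹ * (k.factorial : ℝ)⁻¹ := by
  have h0 : 0 < Real.Gamma (ν + 1) := Real.Gamma_pos_of_pos (by positivity)
  have h1 := Gamma_add_one_le_Gamma_add_nat hν k
  have h2 : 0 < Real.Gamma (ν + k + 1) := h0.trans_le h1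
  have hk : (0 : ℝ) < k.factorial := by positivity
  rw [abs_div, abs_pow, abs_neg, abs_one, one_pow, abs_of_pos (mul_pos hk h2), one_div,
    mul_inv, mul_comm]
  gcongr

lemma summable_besselEntire {ν : ℝ} (hν : 0 ≤ ν) (t : ℝ) :
    Summable fun k : ℕ => (-1 : ℝ) ^ k / (k.factorial * Real.Gamma (ν + k + 1)) * t ^ k := by
  refine Summable.of_norm_bounded
    ((Real.summable_pow_div_factorial |t|).mul_left (Real.Gamma (ν + 1))⁻¹) fun k => ?_
  rw [Real.norm_eq_abs, abs_mul, abs_pow]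
  calc _ ≤ (Real.Gamma (ν + 1))⁻¹ * (k.factorial : ℝ)⁻¹ * |t| ^ k := by
        gcongr
        exact abs_besselEntire_coeff_le hν k
    _ = _ := by ring

lemma besselEntire_deriv_term (ν t : ℝ) (k : ℕ) :
    (-1 : ℝ) ^ (k + 1) / ((k + 1).factorial * Real.Gamma (ν + (k + 1 : ℕ) + 1))
        * ((k + 1 : ℕ) * t ^ (k + 1 - 1))
      = -((-1 : ℝ) ^ k / (k.factorial * Real.Gamma (ν + 1 + k + 1)) * t ^ k) := by
  have h : ν + ((k + 1 : ℕ) : ℝ) + 1 = ν + 1 + k + 1 := by push_cast; ring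
  have hk : ((k : ℝ) + 1) ≠ 0 := by positivity
  rw [h, Nat.factorial_succ, Nat.add_sub_cancel, pow_succ]
  push_cast
  rw [mul_assoc ((k : ℝ) + 1), ← mul_assoc _ ((k : ℝ) + 1), div_mul_eq_mul_div,
    mul_comm _ ((k : ℝ) + 1), mul_div_mul_left _ _ hk]
  ring

lemma hasDerivAt_besselEntire {ν : ℝ} (hν : 0 ≤ ν) (t : ℝ) :
    HasDerivAt (besselEntire ν) (-besselEntire (ν + 1) t) t := by
  set R : ℝ := |t| + 1 with hR
  have hbound : Summable fun k : ℕ =>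
      (Real.Gamma (ν + 1))⁻¹ * (k.factorial : ℝ)⁻¹ * (k * R ^ (k - 1)) := by
    rw [← summable_nat_add_iff 1]
    refine ((Real.summable_pow_div_factorial R).mul_left (Real.Gamma (ν + 1))⁻¹).congr fun k => ?_
    have hk : ((k : ℝ) + 1) ≠ 0 := by positivity
    have hf : (k.factorial : ℝ) ≠ 0 := by positivity
    rw [Nat.factorial_succ, Nat.add_sub_cancel]
    push_cast
    field_simp
  have ht : t ∈ Metric.ball (0 : ℝ) R := by simp [hR]
  have key := hasDerivAt_tsum_of_isPreconnected hbound Metric.isOpen_ball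
    (convex_ball (0 : ℝ) R).isPreconnected
    (g := fun (k : ℕ) (s : ℝ) =>
      (-1 : ℝ) ^ k / (k.factorial * Real.Gamma (ν + k + 1)) * s ^ k)
    (g' := fun (k : ℕ) (s : ℝ) =>
      (-1 : ℝ) ^ k / (k.factorial * Real.Gamma (ν + k + 1)) * (k * s ^ (k - 1)))
    (fun k s _ => (hasDerivAt_pow k s).const_mul _)
    (fun k s hs => by
      have hs' : |s| ≤ R := by simpa using (Metric.mem_ball.1 hs).le
      rw [Real.norm_eq_abs, abs_mul, abs_mul, abs_pow, Nat.abs_cast]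
      have := abs_besselEntire_coeff_le hν k
      gcongr)
    ht (summable_besselEntire hν t) ht
  refine HasDerivAt.congr_deriv key ?_
  have hsum : Summable fun k : ℕ =>
      (-1 : ℝ) ^ k / (k.factorial * Real.Gamma (ν + k + 1)) * (k * t ^ (k - 1)) := by
    rw [← summable_nat_add_iff 1]
    exact (summable_besselEntire (by positivity : 0 ≤ ν + 1) t).neg.congr
      fun k => (besselEntire_deriv_term ν t k).symm
  rw [hsum.tsum_eq_zero_add, tsum_congr (besselEntire_deriv_term ν t), tsum_neg]
  simp [besselEntire]

lemma besselEntire_recurrence {ν : ℝ} (hν : 0 ≤ ν) (t : ℝ) :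
    besselEntire ν t
      = (ν + 1) * besselEntire (ν + 1) t - t * besselEntire (ν + 2) t := by
  have h0 := summable_besselEntire hν t
  have h1 := summable_besselEntire (by positivity : 0 ≤ ν + 1) t
  have h2 := summable_besselEntire (by positivity : 0 ≤ ν + 2) t
  have hdiff := h0.sub (h1.mul_left (ν + 1))
  suffices h : besselEntire ν t - (ν + 1) * besselEntire (ν + 1) t
      = -(t * besselEntire (ν + 2) t) by linarith
  unfold besselEntire
  rw [← tsum_mul_left, ← h0.tsum_sub (h1.mul_left (ν + 1)), hdiff.tsum_eq_zero_add,
    ← tsum_mul_left, ← tsum_neg]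
  have hz : ν + 1 ≠ 0 := by positivity
  have hzero : (-1 : ℝ) ^ 0 / ((Nat.factorial 0) * Real.Gamma (ν + (0 : ℕ) + 1)) * t ^ 0
      - (ν + 1) * ((-1 : ℝ) ^ 0 / ((Nat.factorial 0) * Real.Gamma (ν + 1 + (0 : ℕ) + 1)) * t ^ 0)
      = 0 := by
    have hG : Real.Gamma (ν + 1) ≠ 0 := (Real.Gamma_pos_of_pos (by positivity)).ne'
    simp only [Nat.cast_zero, add_zero, Real.Gamma_add_one hz, Nat.factorial_zero, Nat.cast_one,
      pow_zero]
    field_simp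
    ring
  rw [hzero, zero_add]
  refine tsum_congr fun k => ?_
  have hpos : 0 < ν + k + 2 := by positivity
  have hG : Real.Gamma (ν + k + 2) ≠ 0 := (Real.Gamma_pos_of_pos hpos).ne'
  have e0 : ν + ((k + 1 : ℕ) : ℝ) + 1 = ν + k + 2 := by push_cast; ring
  have e1 : ν + 1 + ((k + 1 : ℕ) : ℝ) + 1 = (ν + k + 2) + 1 := by push_cast; ring
  have e2 : ν + 2 + (k : ℝ) + 1 = (ν + k + 2) + 1 := by ring
  have hf : (k.factorial : ℝ) ≠ 0 := by positivity
  have hk : (k : ℝ) + 1 ≠ 0 := by positivity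
  rw [e0, e1, e2, Real.Gamma_add_one hpos.ne', Nat.factorial_succ]
  push_cast
  field_simp
  ring

lemma besselJ_eq_rpow_mul_besselEntire (ν : ℝ) {z : ℝ} (hz : 0 < z) :
    besselJ ν z = (z / 2) ^ ν * besselEntire ν ((z / 2) ^ 2) := by
  unfold besselJ besselEntire
  rw [← tsum_mul_left]
  refine tsum_congr fun k => ?_
  have hz2 : 0 < z / 2 := by positivity
  have h : (z / 2) ^ (ν + 2 * (k : ℝ)) = (z / 2) ^ ν * ((z / 2) ^ 2) ^ k := by
    rw [Real.rpow_add hz2, ← pow_mul, ← Real.rpow_natCast]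
    push_cast
    rfl
  rw [h]
  ring

lemma sqrt_mul_besselJ_eq (l : ℝ) {ω x : ℝ} (hω : 0 < ω) (hx : 0 < x) :
    Real.sqrt (ω * x) * besselJ (l + 1 / 2) (ω * x)
      = Real.sqrt ω * (ω / 2) ^ (l + 1 / 2)
        * (x ^ (l + 1) * besselEntire (l + 1 / 2) (ω ^ 2 / 4 * x ^ 2)) := by
  have e1 : ω * x / 2 = ω / 2 * x := by ring
  have e2 : (ω / 2 * x) ^ 2 = ω ^ 2 / 4 * x ^ 2 := by ring
  have e3 : x ^ (l + 1) = Real.sqrt x * x ^ (l + 1 / 2) := by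
    rw [Real.sqrt_eq_rpow, ← Real.rpow_add hx]
    ring_nf
  rw [besselJ_eq_rpow_mul_besselEntire _ (mul_pos hω hx), e1, e2,
    Real.mul_rpow (by positivity) hx.le, Real.sqrt_mul hω.le, e3]
  ring

lemma hasDerivAt_rpow_mul_besselEntire {ν : ℝ} (hν : 0 ≤ ν) (p a : ℝ) {x : ℝ} (hx : 0 < x) :
    HasDerivAt (fun y : ℝ => y ^ p * besselEntire ν (a * y ^ 2))
      (p * (x ^ (p - 1) * besselEntire ν (a * x ^ 2))
        - 2 * a * (x ^ (p + 1) * besselEntire (ν + 1) (a * x ^ 2))) x := by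
  have h1 := Real.hasDerivAt_rpow_const (x := x) (p := p) (Or.inl hx.ne')
  have h2 : HasDerivAt (fun y : ℝ => a * y ^ 2) (a * (2 * x)) x := by
    simpa using (hasDerivAt_pow 2 x).const_mul a
  have h3 := (hasDerivAt_besselEntire hν (a * x ^ 2)).comp x h2
  refine HasDerivAt.congr_deriv (h1.mul h3) ?_
  rw [Real.rpow_add_one hx.ne']
  ring

/-- `v(x) = √(ωx)·J_{l+1/2}(ωx)` is twice differentiable on `(0,∞)` and
satisfies `v'' - (l(l+1)/x²) v = -ω² v` there. -/
theorem stmt3 (l : ℝ) (hl : -(1/2) ≤ l) (ω : ℝ) (hω : 0 < ω) :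
    ∀ x > (0:ℝ),
      DifferentiableAt ℝ (fun y : ℝ => Real.sqrt (ω*y) * besselJ (l + 1/2) (ω*y)) x ∧
      DifferentiableAt ℝ (deriv (fun y : ℝ => Real.sqrt (ω*y) * besselJ (l + 1/2) (ω*y))) x ∧
      deriv (deriv (fun y : ℝ => Real.sqrt (ω*y) * besselJ (l + 1/2) (ω*y))) x
          - (l*(l+1)/x^2) * (Real.sqrt (ω*x) * besselJ (l + 1/2) (ω*x))
        = -(ω^2) * (Real.sqrt (ω*x) * besselJ (l + 1/2) (ω*x)) := by
  intro x hx
  have hν : 0 ≤ l + 1 / 2 := by linarith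
  set C : ℝ := Real.sqrt ω * (ω / 2) ^ (l + 1 / 2)
  set a : ℝ := ω ^ 2 / 4 with ha
  set v : ℝ → ℝ := fun y => Real.sqrt (ω * y) * besselJ (l + 1 / 2) (ω * y)
  have hvx : ∀ y > 0, v y = C * (y ^ (l + 1) * besselEntire (l + 1 / 2) (a * y ^ 2)) :=
    fun y hy => sqrt_mul_besselJ_eq l hω hy
  have hd1 : ∀ y > 0, HasDerivAt v
      (C * ((l + 1) * (y ^ (l + 1 - 1) * besselEntire (l + 1 / 2) (a * y ^ 2))
        - 2 * a * (y ^ (l + 1 + 1) * besselEntire (l + 1 / 2 + 1) (a * y ^ 2)))) y := by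
    intro y hy
    refine ((hasDerivAt_rpow_mul_besselEntire hν (l + 1) a hy).const_mul C).congr_of_eventuallyEq ?_
    filter_upwards [lt_mem_nhds hy] with z hz using hvx z hz
  have hd2 := ((((hasDerivAt_rpow_mul_besselEntire hν (l + 1 - 1) a hx).const_mul (l + 1)).sub
    ((hasDerivAt_rpow_mul_besselEntire (by positivity : 0 ≤ l + 1 / 2 + 1) (l + 1 + 1) a
      hx).const_mul (2 * a))).const_mul C).congr_of_eventuallyEq (f₁ := deriv v) (by
    filter_upwards [lt_mem_nhds hx] with z hz using (hd1 z hz).deriv)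
  refine ⟨(hd1 x hx).differentiableAt, hd2.differentiableAt, ?_⟩
  change _ - _ * v x = _ * v x
  have hrec := besselEntire_recurrence hν (a * x ^ 2)
  have e1 : x ^ (l + 1 - 1 - 1) = x ^ (l + 1) / x ^ 2 := by
    rw [← Real.rpow_natCast x 2, ← Real.rpow_sub hx]
    push_cast
    ring_nf
  have e2 : x ^ (l + 1 + 1 + 1) = x ^ (l + 1) * x ^ 2 := by
    rw [Real.rpow_add_one hx.ne', Real.rpow_add_one hx.ne']
    ring
  have e3 : l + 1 - 1 + 1 = l + 1 := by ring
  have e4 : l + 1 + 1 - 1 = l + 1 := by ring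
  have e5 : l + 1 / 2 + 1 + 1 = l + 1 / 2 + 2 := by ring
  have hω2 : ω ^ 2 = 4 * a := by rw [ha]; ring
  rw [hd2.deriv, hvx x hx, e1, e2, e3, e4, e5, hω2]
  linear_combination (4 * a * C * x ^ (l + 1)) * hrec
end

section
/- Let l≥−1/2 be real with l∉{0,1,2,...} and let k be a nonnegative integer. Then there exists a constant c>0 (depending on l and k) such that for every x>0 and every integer n ≥ l+k+2: |∫_0^x (1 − t²/x²)^{l+k} · P_{2n}(t/x) dt| ≤ c·x / n^{2l+2k+2}. -/
open MeasureTheory Filter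

/-- The Legendre polynomial of degree `m` (Rodrigues formula). -/
noncomputable def legendreP (m : ℕ) (s : ℝ) : ℝ :=
  (1 / (2^m * (Nat.factorial m))) * iteratedDeriv m (fun y => (y^2 - 1)^m) s

open Polynomial in
/-- Leibniz rule for iterated derivatives of `X * p`. -/
theorem iterate_derivative_succ_X_mul (n : ℕ) (p : ℝ[X]) :
    derivative^[n + 1] (X * p) = X * derivative^[n + 1] p + ((n : ℝ[X]) + 1) * derivative^[n] p := by
  induction n with
  | zero => simp [derivative_mul]; ring
  | succ n ih =>
    rw [Function.iterate_succ_apply', ih]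
    simp only [derivative_add, derivative_mul, derivative_X, derivative_natCast, derivative_one,
      Function.iterate_succ_apply']
    push_cast
    ring

open Polynomial in
theorem iterate_derivative_X_mul_derivative (n : ℕ) (p : ℝ[X]) :
    derivative^[n] (X * derivative p) =
      X * derivative^[n + 1] p + (n : ℝ[X]) * derivative^[n] p := by
  cases n with
  | zero => simp
  | succ n =>
    rw [iterate_derivative_succ_X_mul]
    simp only [Function.iterate_succ_apply]
    push_cast
    ring

open Polynomial in
/-- The unnormalized Rodrigues polynomial `(d/dX)^m (X² - 1)^m`. -/
noncomputable def rodrigues (m : ℕ) : ℝ[X] := derivative^[m] ((X ^ 2 - 1) ^ m)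

open Polynomial in
theorem derivative_X_sq_sub_one_pow (m : ℕ) :
    derivative ((X ^ 2 - 1 : ℝ[X]) ^ (m + 1)) =
      C (2 * ((m : ℝ) + 1)) * (X * (X ^ 2 - 1) ^ m) := by
  simp only [derivative_pow, derivative_sub, derivative_X, derivative_one]
  simp
  ring

open Polynomial in
theorem derivative_rodrigues_succ (m : ℕ) :
    derivative (rodrigues (m + 1)) =
      C (2 * ((m : ℝ) + 1)) *
        (X * derivative (rodrigues m) + ((m : ℝ[X]) + 1) * rodrigues m) := by
  unfold rodrigues
  rw [← Function.iterate_succ_apply' (f := derivative), Function.iterate_succ_apply,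
    derivative_X_sq_sub_one_pow, iterate_derivative_C_mul, iterate_derivative_succ_X_mul,
    Function.iterate_succ_apply']

open Polynomial in
/-- The Legendre equation, integrated once. -/
theorem X_sq_sub_one_mul_derivative_rodrigues (j : ℕ) :
    (X ^ 2 - 1) * derivative (rodrigues (j + 1)) =
      ((j : ℝ[X]) + 1) * ((j : ℝ[X]) + 2) * derivative^[j] ((X ^ 2 - 1) ^ (j + 1)) := by
  unfold rodrigues
  set u : ℝ[X] := (X ^ 2 - 1) ^ (j + 1) with hu
  have h : X * (X * derivative u) - derivative u = C (2 * ((j : ℝ) + 1)) * (X * u) := by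
    rw [hu, derivative_X_sq_sub_one_pow]; ring
  have h' := congrArg (fun p => derivative^[j + 1] p) h
  simp only [iterate_derivative_sub, iterate_derivative_C_mul] at h'
  rw [iterate_derivative_succ_X_mul, iterate_derivative_X_mul_derivative,
    iterate_derivative_X_mul_derivative, iterate_derivative_succ_X_mul] at h'
  rw [← Function.iterate_succ_apply' (f := derivative)]
  rw [← Function.iterate_succ_apply (f := derivative)] at h'
  simp only [Nat.succ_eq_add_one] at *
  push_cast at h'
  simp only [map_mul, map_add, map_natCast, map_one, map_ofNat] at h'
  linear_combination h'

open Polynomial in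
theorem rodrigues_succ (m : ℕ) :
    ((m : ℝ[X]) + 1) * rodrigues (m + 1) =
      C (2 * ((m : ℝ) + 1)) *
        (((m : ℝ[X]) + 1) * (X * rodrigues m) + (X ^ 2 - 1) * derivative (rodrigues m)) := by
  cases m with
  | zero => simp [rodrigues, one_add_one_eq_two]
  | succ j =>
    rw [X_sq_sub_one_mul_derivative_rodrigues]
    unfold rodrigues
    rw [Function.iterate_succ_apply, derivative_X_sq_sub_one_pow (j + 1), iterate_derivative_C_mul,
      iterate_derivative_succ_X_mul]
    push_cast
    ring

open Polynomial in
/-- The Legendre polynomial as a formal polynomial. -/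
noncomputable def legendrePoly (m : ℕ) : ℝ[X] :=
  C (1 / (2 ^ m * (Nat.factorial m : ℝ))) * rodrigues m

open Polynomial in
theorem legendreP_eq_eval (m : ℕ) (s : ℝ) : legendreP m s = (legendrePoly m).eval s := by
  have h : ∀ (n : ℕ) (p : ℝ[X]),
      iteratedDeriv n (fun y => p.eval y) = fun y => (derivative^[n] p).eval y := by
    intro n
    induction n with
    | zero => intro p; simp
    | succ n ih =>
      intro p
      rw [iteratedDeriv_succ, ih]
      funext y
      rw [Polynomial.deriv, Function.iterate_succ_apply']
  have h' := h m ((X ^ 2 - 1) ^ m)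
  simp only [eval_pow, eval_sub, eval_X, eval_one] at h'
  rw [legendreP, h', legendrePoly, rodrigues, eval_mul, eval_C]

open Polynomial in
theorem C_legendre_factor_succ (m : ℕ) :
    C (1 / (2 ^ (m + 1) * (Nat.factorial (m + 1) : ℝ))) * C (2 * ((m : ℝ) + 1)) =
      C (1 / (2 ^ m * (Nat.factorial m : ℝ))) := by
  rw [← C_mul, Nat.factorial_succ]
  congr 1
  push_cast
  field_simp
  ring

open Polynomial in
theorem derivative_legendrePoly_succ (m : ℕ) :
    derivative (legendrePoly (m + 1)) =
      X * derivative (legendrePoly m) + ((m : ℝ[X]) + 1) * legendrePoly m := by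
  simp only [legendrePoly, derivative_C_mul]
  rw [derivative_rodrigues_succ, ← mul_assoc, C_legendre_factor_succ]
  ring

open Polynomial in
theorem succ_mul_legendrePoly_succ (m : ℕ) :
    ((m : ℝ[X]) + 1) * legendrePoly (m + 1) =
      ((m : ℝ[X]) + 1) * (X * legendrePoly m) + (X ^ 2 - 1) * derivative (legendrePoly m) := by
  simp only [legendrePoly, derivative_C_mul]
  rw [mul_left_comm, rodrigues_succ, ← mul_assoc, C_legendre_factor_succ]
  ring

open Polynomial in
theorem succ_mul_legendrePoly (m : ℕ) :
    ((m : ℝ[X]) + 1) * legendrePoly m =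
      ((m : ℝ[X]) + 1) * (X * legendrePoly (m + 1)) -
        (X ^ 2 - 1) * derivative (legendrePoly (m + 1)) := by
  rw [derivative_legendrePoly_succ]
  linear_combination (-X) * succ_mul_legendrePoly_succ m

open Polynomial in
theorem eval_zero_legendrePoly_odd (n : ℕ) : (legendrePoly (2 * n + 1)).eval 0 = 0 := by
  induction n with
  | zero => simp [legendrePoly, rodrigues]
  | succ n ih =>
    have h₁ := congrArg (eval 0) (succ_mul_legendrePoly_succ (2 * n + 2))
    have h₂ := congrArg (eval 0) (derivative_legendrePoly_succ (2 * n + 1))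
    simp [ih] at h₁ h₂
    rw [h₂] at h₁
    rcases mul_eq_zero.1 (h₁.trans neg_zero) with h | h
    · exact absurd h (by positivity)
    · exact h

/-- The Legendre coefficient of `(1 - s²)^a` over `[0, 1]`. -/
noncomputable def halfLegendreCoeff (a : ℝ) (m : ℕ) : ℝ :=
  ∫ s in (0 : ℝ)..1, (1 - s ^ 2) ^ a * (legendrePoly m).eval s

theorem intervalIntegrable_one_sub_sq_rpow_mul {a : ℝ} (ha : -1 < a) {f : ℝ → ℝ}
    (hf : Continuous f) :
    IntervalIntegrable (fun s : ℝ => (1 - s ^ 2) ^ a * f s) volume 0 1 := by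
  have h₁ : IntervalIntegrable (fun s : ℝ => (1 - s) ^ a) volume 0 1 := by
    simpa using ((intervalIntegral.intervalIntegrable_rpow' ha (a := 0) (b := 1)).comp_sub_left 1).symm
  have h₂ : ContinuousOn (fun s : ℝ => (1 + s) ^ a * f s) (Set.uIcc 0 1) := by
    refine ContinuousOn.mul (ContinuousOn.rpow_const (by fun_prop) ?_) hf.continuousOn
    intro s hs
    rw [Set.uIcc_of_le zero_le_one] at hs
    left
    linarith [hs.1]
  refine (h₁.mul_continuousOn h₂).congr ?_
  intro s hs
  rw [Set.uIoc_of_le zero_le_one] at hs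
  have : (1 - s ^ 2 : ℝ) = (1 - s) * (1 + s) := by ring
  simp only [this, Real.mul_rpow (by linarith [hs.2] : 0 ≤ 1 - s) (by linarith [hs.1] : 0 ≤ 1 + s)]
  ring

open Polynomial in
/-- Integration by parts against the weight `(1 - s²)^a`. -/
theorem integral_one_sub_sq_rpow_mul_derivative {a : ℝ} (ha : -1 < a) (p : ℝ[X])
    (hp : p.eval 0 = 0) :
    ∫ s in (0 : ℝ)..1, (1 - s ^ 2) ^ a * ((1 - s ^ 2) * (derivative p).eval s) =
      2 * (a + 1) * ∫ s in (0 : ℝ)..1, (1 - s ^ 2) ^ a * (s * p.eval s) := by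
  have i₁ := intervalIntegrable_one_sub_sq_rpow_mul ha
    (f := fun s => (1 - s ^ 2) * (derivative p).eval s) (by fun_prop)
  have i₂ := intervalIntegrable_one_sub_sq_rpow_mul ha (f := fun s => s * p.eval s) (by fun_prop)
  have key := intervalIntegral.integral_eq_sub_of_hasDerivAt_of_le zero_le_one
    (f := fun s : ℝ => (1 - s ^ 2) ^ (a + 1) * p.eval s)
    (f' := fun s : ℝ => (1 - s ^ 2) ^ a * ((1 - s ^ 2) * (derivative p).eval s) -
      2 * (a + 1) * ((1 - s ^ 2) ^ a * (s * p.eval s))) ?_ ?_ (i₁.sub (i₂.const_mul _))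
  · rw [intervalIntegral.integral_sub i₁ (i₂.const_mul _),
      intervalIntegral.integral_const_mul] at key
    simp [hp, Real.zero_rpow (by linarith : a + 1 ≠ 0)] at key
    linarith
  · exact ContinuousOn.mul
      (ContinuousOn.rpow_const (by fun_prop) fun s _ => Or.inr (by linarith)) (by fun_prop)
  · intro s hs
    have hpos : 0 < 1 - s ^ 2 := by nlinarith [hs.1, hs.2]
    have h₁ : HasDerivAt (fun s : ℝ => 1 - s ^ 2) (-(2 * s)) s := by
      simpa using (hasDerivAt_pow 2 s).const_sub 1
    have h₂ := (h₁.rpow_const (p := a + 1) (Or.inl hpos.ne')).mul (p.hasDerivAt s)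
    refine h₂.congr_deriv ?_
    rw [add_sub_cancel_right, Real.rpow_add_one hpos.ne']
    ring

open Polynomial in
theorem halfLegendreCoeff_succ {a : ℝ} (ha : -1 < a) (n : ℕ) :
    ((n : ℝ) + 1) * (n + a + 3 / 2) * halfLegendreCoeff a (2 * (n + 1)) =
      (n - a) * (n + 1 / 2) * halfLegendreCoeff a (2 * n) := by
  have hT := integral_one_sub_sq_rpow_mul_derivative ha _ (eval_zero_legendrePoly_odd n)
  set p := legendrePoly (2 * n + 1) with hp
  have i₁ := intervalIntegrable_one_sub_sq_rpow_mul ha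
    (f := fun s => (1 - s ^ 2) * (derivative p).eval s) (by fun_prop)
  have i₂ := intervalIntegrable_one_sub_sq_rpow_mul ha (f := fun s => s * p.eval s) (by fun_prop)
  set S := ∫ s in (0 : ℝ)..1, (1 - s ^ 2) ^ a * (s * p.eval s) with hS
  have hlow : (2 * (n : ℝ) + 1) * halfLegendreCoeff a (2 * n) =
      (2 * (n : ℝ) + 1) * S + 2 * (a + 1) * S := by
    rw [← hT, hS, halfLegendreCoeff, ← intervalIntegral.integral_const_mul,
      ← intervalIntegral.integral_const_mul, ← intervalIntegral.integral_add (i₂.const_mul _) i₁]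
    congr 1
    funext s
    have h := congrArg (eval s) (succ_mul_legendrePoly (2 * n))
    simp [← hp] at h
    linear_combination (1 - s ^ 2) ^ a * h
  have hhigh : (2 * (n : ℝ) + 2) * halfLegendreCoeff a (2 * (n + 1)) =
      (2 * (n : ℝ) + 2) * S - 2 * (a + 1) * S := by
    rw [← hT, hS, halfLegendreCoeff, ← intervalIntegral.integral_const_mul,
      ← intervalIntegral.integral_const_mul, ← intervalIntegral.integral_sub (i₂.const_mul _) i₁]
    congr 1
    funext s
    have h := congrArg (eval s) (succ_mul_legendrePoly_succ (2 * n + 1))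
    simp [← hp] at h
    rw [show 2 * (n + 1) = 2 * n + 1 + 1 by ring]
    linear_combination (1 - s ^ 2) ^ a * h
  linear_combination (n + a + 3 / 2) / 2 * hhigh - (n - a) / 2 * hlow

/-- `1 - q/b ≤ (b/(b+1))^q`. -/
theorem one_sub_div_le_div_rpow {b q : ℝ} (hb : 0 < b) (hq : 0 ≤ q) :
    1 - q / b ≤ (b / (b + 1)) ^ q := by
  have h₁ : 1 - q / b ≤ Real.exp (-(q / b)) := by
    linarith [Real.add_one_le_exp (-(q / b))]
  refine h₁.trans ?_
  rw [Real.rpow_def_of_pos (by positivity), Real.exp_le_exp]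
  have h₂ := Real.one_sub_inv_le_log_of_pos (show 0 < b / (b + 1) by positivity)
  have h₃ : 1 - (b / (b + 1))⁻¹ = -(1 / b) := by field_simp; ring
  rw [h₃] at h₂
  calc -(q / b) = -(1 / b) * q := by ring
    _ ≤ _ := mul_le_mul_of_nonneg_right h₂ hq

theorem abs_halfLegendreCoeff_mul_antitone {a : ℝ} (ha : -1 < a) {n : ℕ} (hn : a ≤ n) :
    |halfLegendreCoeff a (2 * (n + 1))| *
        (((n : ℝ) + 2) ^ (a + 1) * (n + a + 5 / 2) ^ (a + 1)) ≤
      |halfLegendreCoeff a (2 * n)| *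
        (((n : ℝ) + 1) ^ (a + 1) * (n + a + 3 / 2) ^ (a + 1)) := by
  have hn0 : (0 : ℝ) ≤ n := n.cast_nonneg
  have hb : 0 < (n : ℝ) + 1 := by positivity
  have hd : 0 < (n : ℝ) + a + 3 / 2 := by linarith
  have hrec := halfLegendreCoeff_succ ha n
  have hratio : halfLegendreCoeff a (2 * (n + 1)) =
      ((1 - (a + 1) / (n + 1)) * (1 - (a + 1) / (n + a + 3 / 2))) *
        halfLegendreCoeff a (2 * n) := by
    have e₁ : 1 - (a + 1) / ((n : ℝ) + 1) = (n - a) / (n + 1) := by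
      rw [eq_div_iff hb.ne', sub_mul, div_mul_cancel₀ _ hb.ne']; ring
    have e₂ : 1 - (a + 1) / ((n : ℝ) + a + 3 / 2) = (n + 1 / 2) / (n + a + 3 / 2) := by
      rw [eq_div_iff hd.ne', sub_mul, div_mul_cancel₀ _ hd.ne']; ring
    rw [e₁, e₂, div_mul_div_comm, div_mul_eq_mul_div, eq_div_iff (mul_pos hb hd).ne']
    linear_combination hrec
  have f₁ := one_sub_div_le_div_rpow hb (by linarith : 0 ≤ a + 1)
  have f₂ := one_sub_div_le_div_rpow hd (by linarith : 0 ≤ a + 1)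
  have p₁ : 0 ≤ 1 - (a + 1) / ((n : ℝ) + 1) := by
    rw [sub_nonneg, div_le_one hb]; linarith
  have p₂ : 0 ≤ 1 - (a + 1) / ((n : ℝ) + a + 3 / 2) := by
    rw [sub_nonneg, div_le_one hd]; linarith
  rw [Real.div_rpow hb.le (by linarith), le_div_iff₀ (Real.rpow_pos_of_pos (by linarith) _),
    show (n : ℝ) + 1 + 1 = n + 2 by ring] at f₁
  rw [Real.div_rpow hd.le (by linarith), le_div_iff₀ (Real.rpow_pos_of_pos (by linarith) _),
    show (n : ℝ) + a + 3 / 2 + 1 = n + a + 5 / 2 by ring] at f₂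
  rw [hratio, abs_mul, abs_of_nonneg (mul_nonneg p₁ p₂)]
  have := mul_le_mul f₁ f₂ (mul_nonneg p₂ (Real.rpow_nonneg (by linarith) _))
    (Real.rpow_nonneg hb.le _)
  have := mul_le_mul_of_nonneg_left this (abs_nonneg (halfLegendreCoeff a (2 * n)))
  linarith

theorem exists_abs_halfLegendreCoeff_le {a : ℝ} (ha : -1 < a) :
    ∃ c > (0 : ℝ), ∀ n : ℕ, 0 < n → a + 1 ≤ n →
      |halfLegendreCoeff a (2 * n)| ≤ c / (n : ℝ) ^ (2 * a + 2) := by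
  set w : ℕ → ℝ := fun n => |halfLegendreCoeff a (2 * n)| *
    (((n : ℝ) + 1) ^ (a + 1) * (n + a + 3 / 2) ^ (a + 1)) with hw
  have hmono : ∀ n : ℕ, ⌈a⌉₊ ≤ n → w n ≤ w ⌈a⌉₊ := by
    intro n hn
    induction n, hn using Nat.le_induction with
    | base => exact le_rfl
    | succ n hn ih =>
      refine le_trans ?_ ih
      have := abs_halfLegendreCoeff_mul_antitone ha (Nat.ceil_le.1 hn)
      simp only [hw]
      push_cast
      rw [show (n : ℝ) + 1 + 1 = n + 2 by ring, show (n : ℝ) + 1 + a + 3 / 2 = n + a + 5 / 2 by ring]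
      exact this
  have hw0 : 0 ≤ w ⌈a⌉₊ := by
    have : a ≤ ⌈a⌉₊ := Nat.le_ceil a
    have : (0 : ℝ) ≤ ⌈a⌉₊ := Nat.cast_nonneg _
    have := Real.rpow_nonneg (by linarith : 0 ≤ (⌈a⌉₊ : ℝ) + a + 3 / 2) (a + 1)
    simp only [hw]
    positivity
  refine ⟨w ⌈a⌉₊ + 1, by linarith, fun n hn0 hn => ?_⟩
  have hpos : (0 : ℝ) < n := by exact_mod_cast hn0
  rw [le_div_iff₀ (Real.rpow_pos_of_pos hpos _)]
  have h₁ : (n : ℝ) ^ (2 * a + 2) ≤ ((n : ℝ) + 1) ^ (a + 1) * (n + a + 3 / 2) ^ (a + 1) := by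
    rw [show 2 * a + 2 = (a + 1) + (a + 1) by ring, Real.rpow_add hpos]
    exact mul_le_mul (Real.rpow_le_rpow hpos.le (by linarith) (by linarith))
      (Real.rpow_le_rpow hpos.le (by linarith) (by linarith)) (by positivity) (by positivity)
  have h₂ := hmono n (Nat.ceil_le.2 (by linarith))
  have h₃ := mul_le_mul_of_nonneg_left h₁ (abs_nonneg (halfLegendreCoeff a (2 * n)))
  linarith

theorem integral_eq_mul_halfLegendreCoeff (a : ℝ) (m : ℕ) {x : ℝ} (hx : 0 < x) :
    ∫ t in (0 : ℝ)..x, (1 - t ^ 2 / x ^ 2) ^ a * legendreP m (t / x) =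
      x * halfLegendreCoeff a m := by
  have h := intervalIntegral.integral_comp_div (a := 0) (b := x)
    (fun s : ℝ => (1 - s ^ 2) ^ a * (legendrePoly m).eval s) hx.ne'
  rw [zero_div, div_self hx.ne', smul_eq_mul] at h
  rw [halfLegendreCoeff, ← h]
  simp only [legendreP_eq_eval, div_pow]

/-- decay of the Fourier–Legendre coefficients of `(1 - t²/x²)^{l+k}`
for non-integer `l ≥ -1/2`. -/
theorem stmt10 (l : ℝ) (hl : -(1/2) ≤ l) (hlni : ∀ m : ℕ, l ≠ m) (k : ℕ) :
    ∃ c > (0:ℝ), ∀ x > (0:ℝ), ∀ n : ℕ, l + k + 2 ≤ (n:ℝ) →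
      |∫ t in (0:ℝ)..x, (1 - t^2/x^2) ^ (l + k) * legendreP (2*n) (t/x)|
        ≤ c * x / (n:ℝ) ^ (2*l + 2*(k:ℝ) + 2) := by
  have hk : (0 : ℝ) ≤ k := k.cast_nonneg
  obtain ⟨c, hc, h⟩ := exists_abs_halfLegendreCoeff_le (a := l + k) (by linarith)
  refine ⟨c, hc, fun x hx n hn => ?_⟩
  have hn0 : (0 : ℝ) < n := by linarith
  rw [integral_eq_mul_halfLegendreCoeff _ _ hx, abs_mul, abs_of_pos hx, mul_comm c x, mul_div_assoc,
    show 2 * l + 2 * (k : ℝ) + 2 = 2 * (l + k) + 2 by ring]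
  exact mul_le_mul_of_nonneg_left (h n (by exact_mod_cast hn0) (by linarith)) hx.le
end

section
/- Let b>0, let p≥1 be an integer, and define the operator H_p on functions f:[0,b]→ℂ by H_p f(x) = x^{−p} ∫_0^x t^{p−1} f(t) dt for x∈(0,b] and H_p f(0) = f(0)/p. If f is r times continuously differentiable on [0,b] for some integer r≥0, then H_p f is r times continuously differentiable on [0,b] and (H_p f)^{(r)} = H_{p+r}(f^{(r)}). -/
open MeasureTheory Filter

/-- The operator H_p. -/
noncomputable def Hop (p : ℕ) (f : ℝ → ℂ) (x : ℝ) : ℂ :=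
  if x = 0 then f 0 / p
  else (∫ t in (0:ℝ)..x, (t:ℂ)^(p-1) * f t) / (x:ℂ)^p

theorem Hop_congr {b : ℝ} (p : ℕ) {f g : ℝ → ℂ} (hfg : Set.EqOn f g (Set.Icc 0 b)) :
    Set.EqOn (Hop p f) (Hop p g) (Set.Icc 0 b) := by
  intro x hx
  unfold Hop
  split_ifs with h
  · rw [hfg ⟨le_rfl, hx.1.trans hx.2⟩]
  · congr 1
    refine intervalIntegral.integral_congr fun t ht => ?_
    rw [Set.uIcc_of_le hx.1] at ht
    simp only [hfg ⟨ht.1, ht.2.trans hx.2⟩]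

/-- `H_p f` as an average of the dilates of `f`. -/
theorem Hop_eq_integral_comp_mul {p : ℕ} (hp : 1 ≤ p) (f : ℝ → ℂ) (x : ℝ) :
    Hop p f x = ∫ s in (0:ℝ)..1, (s:ℂ) ^ (p - 1) * f (s * x) := by
  obtain ⟨q, rfl⟩ := Nat.exists_eq_add_of_le' hp
  have hq : (q : ℂ) + 1 ≠ 0 := by exact_mod_cast q.succ_ne_zero
  unfold Hop
  split_ifs with h
  · subst h
    have hpow : ∫ s in (0:ℝ)..1, (s:ℂ) ^ q = 1 / ((q : ℂ) + 1) := by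
      have := integral_pow (a := 0) (b := 1) q
      simp only [← Complex.ofReal_pow, intervalIntegral.integral_ofReal, this]
      simp
    simp only [mul_zero, Nat.add_sub_cancel, intervalIntegral.integral_mul_const, hpow]
    push_cast
    ring
  · have hx : (x : ℂ) ≠ 0 := by exact_mod_cast h
    have := intervalIntegral.integral_comp_mul_right (a := 0) (b := 1)
      (fun t : ℝ => (t:ℂ) ^ q * f t) h
    simp only [zero_mul, one_mul, Complex.ofReal_mul, mul_pow, mul_right_comm _ ((x : ℂ) ^ q),
      intervalIntegral.integral_mul_const, Complex.real_smul, Complex.ofReal_inv] at this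
    rw [Nat.add_sub_cancel, div_eq_iff (pow_ne_zero _ hx), pow_succ, ← mul_assoc, this]
    field_simp

theorem continuous_Hop {p : ℕ} (hp : 1 ≤ p) {f : ℝ → ℂ} (hf : Continuous f) :
    Continuous (Hop p f) := by
  rw [funext (Hop_eq_integral_comp_mul hp f)]
  exact intervalIntegral.continuous_parametric_intervalIntegral_of_continuous' (by fun_prop) 0 1

theorem hasDerivAt_Hop {p : ℕ} (hp : 1 ≤ p) {f f' : ℝ → ℂ} (hf : ∀ x, HasDerivAt f (f' x) x)
    (hf' : Continuous f') (x : ℝ) : HasDerivAt (Hop p f) (Hop (p + 1) f' x) x := by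
  have hfc : Continuous f := continuous_iff_continuousAt.2 fun y => (hf y).continuousAt
  rw [funext (Hop_eq_integral_comp_mul hp f), Hop_eq_integral_comp_mul (Nat.le_add_left 1 p) f' x,
    Nat.add_sub_cancel]
  obtain ⟨C, hC⟩ := ((isCompact_Icc (a := (0:ℝ)) (b := 1)).prod
    (isCompact_closedBall x 1)).exists_bound_of_continuousOn
    (f := fun z : ℝ × ℝ => (z.1 : ℂ) ^ p * f' (z.1 * z.2)) (by fun_prop)
  refine (intervalIntegral.hasDerivAt_integral_of_dominated_loc_of_deriv_le
    (F' := fun y s => (s : ℂ) ^ p * f' (s * y)) (bound := fun _ => C)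
    (Metric.closedBall_mem_nhds x one_pos) (.of_forall fun y => ?_) ?_ ?_
    (.of_forall fun s hs y hy => ?_) intervalIntegrable_const
    (.of_forall fun s _ y _ => ?_)).2
  · exact Continuous.aestronglyMeasurable (by fun_prop)
  · exact Continuous.intervalIntegrable (by fun_prop) _ _
  · exact Continuous.aestronglyMeasurable (by fun_prop)
  · rw [Set.uIoc_of_le zero_le_one] at hs
    exact hC (s, y) ⟨Set.Ioc_subset_Icc_self hs, hy⟩
  · have h := ((hf (s * y)).scomp y ((hasDerivAt_id y).const_mul s)).const_mul
      ((s : ℂ) ^ (p - 1))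
    rwa [Complex.real_smul, ← mul_assoc, mul_one, ← pow_succ, Nat.sub_add_cancel hp] at h

theorem exists_continuous_extension_Icc {b : ℝ} (hb : 0 < b) {f : ℝ → ℂ}
    (hf : ContinuousOn f (Set.Icc 0 b)) :
    ∃ g : ℝ → ℂ, Continuous g ∧ Set.EqOn f g (Set.Icc 0 b) :=
  ⟨Set.IccExtend hb.le ((Set.Icc 0 b).domRestrict f), hf.domRestrict.Icc_extend',
    fun _ hx => (Set.IccExtend_of_mem hb.le ((Set.Icc 0 b).domRestrict f) hx).symm⟩

theorem continuousOn_Hop {b : ℝ} (hb : 0 < b) {p : ℕ} (hp : 1 ≤ p) {f : ℝ → ℂ}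
    (hf : ContinuousOn f (Set.Icc 0 b)) : ContinuousOn (Hop p f) (Set.Icc 0 b) := by
  obtain ⟨g, hg, hfg⟩ := exists_continuous_extension_Icc hb hf
  exact (continuous_Hop hp hg).continuousOn.congr (Hop_congr p hfg)

/-- A `C¹` function on `[0, b]` extends to a `C¹` function on `ℝ`. -/
theorem exists_hasDerivAt_extension_Icc {b : ℝ} (hb : 0 < b) {f : ℝ → ℂ}
    (hf : DifferentiableOn ℝ f (Set.Icc 0 b))
    (hf' : ContinuousOn (derivWithin f (Set.Icc 0 b)) (Set.Icc 0 b)) :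
    ∃ g g' : ℝ → ℂ, (∀ x, HasDerivAt g (g' x) x) ∧ Continuous g' ∧
      Set.EqOn f g (Set.Icc 0 b) ∧ Set.EqOn (derivWithin f (Set.Icc 0 b)) g' (Set.Icc 0 b) := by
  obtain ⟨g', hcont, heq⟩ := exists_continuous_extension_Icc hb hf'
  refine ⟨fun x => f 0 + ∫ t in (0:ℝ)..x, g' t, g',
    fun x => (hcont.integral_hasStrictDerivAt 0 x).hasDerivAt.const_add _, hcont,
    fun x hx => ?_, heq⟩
  have hsub : Set.Icc 0 x ⊆ Set.Icc 0 b := Set.Icc_subset_Icc_right hx.2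
  have := intervalIntegral.integral_eq_sub_of_hasDerivAt_of_le hx.1 (hf.continuousOn.mono hsub)
    (f' := g') (fun y hy => ?_) (hcont.intervalIntegrable _ _)
  · simp [this]
  · have hy' := hsub (Set.Ioo_subset_Icc_self hy)
    rw [← heq hy']
    exact (hf y hy').hasDerivWithinAt.hasDerivAt (Icc_mem_nhds hy.1 (hy.2.trans_le hx.2))

theorem hasDerivWithinAt_Hop {b : ℝ} (hb : 0 < b) {p : ℕ} (hp : 1 ≤ p) {f : ℝ → ℂ}
    (hf : DifferentiableOn ℝ f (Set.Icc 0 b))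
    (hf' : ContinuousOn (derivWithin f (Set.Icc 0 b)) (Set.Icc 0 b)) {x : ℝ}
    (hx : x ∈ Set.Icc 0 b) :
    HasDerivWithinAt (Hop p f) (Hop (p + 1) (derivWithin f (Set.Icc 0 b)) x) (Set.Icc 0 b) x := by
  obtain ⟨g, g', hg, hg'c, hfg, hfg'⟩ := exists_hasDerivAt_extension_Icc hb hf hf'
  rw [Hop_congr (p + 1) hfg' hx]
  exact (hasDerivAt_Hop hp hg hg'c x).hasDerivWithinAt.congr (Hop_congr p hfg) (Hop_congr p hfg hx)

/-- if `f ∈ C^r[0,b]` then `H_p f ∈ C^r[0,b]` and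
`(H_p f)^{(r)} = H_{p+r}(f^{(r)})`. -/
theorem stmt17 (b : ℝ) (hb : 0 < b) (p : ℕ) (hp : 1 ≤ p) (r : ℕ) (f : ℝ → ℂ)
    (hf : ContDiffOn ℝ r f (Set.Icc 0 b)) :
    ContDiffOn ℝ r (Hop p f) (Set.Icc 0 b) ∧
    ∀ x ∈ Set.Icc (0:ℝ) b,
      iteratedDerivWithin r (Hop p f) (Set.Icc 0 b) x
        = Hop (p + r) (iteratedDerivWithin r f (Set.Icc 0 b)) x := by
  have hu := uniqueDiffOn_Icc hb
  induction r generalizing p f with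
  | zero =>
    have hf0 : ContinuousOn f (Set.Icc 0 b) := hf.continuousOn
    refine ⟨by simpa using continuousOn_Hop hb hp hf0, fun x hx => ?_⟩
    simp only [iteratedDerivWithin_zero, add_zero]
  | succ r ih =>
    push_cast at hf ⊢
    obtain ⟨hd, -, hf'⟩ := (contDiffOn_succ_iff_derivWithin hu).1 hf
    have hderiv := fun x hx => hasDerivWithinAt_Hop hb hp hd hf'.continuousOn (x := x) hx
    have heq : Set.EqOn (derivWithin (Hop p f) (Set.Icc 0 b))
        (Hop (p + 1) (derivWithin f (Set.Icc 0 b))) (Set.Icc 0 b) :=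
      fun x hx => (hderiv x hx).derivWithin (hu x hx)
    obtain ⟨hC, hI⟩ := ih (p + 1) (Nat.le_add_left 1 p) _ hf'
    refine ⟨(contDiffOn_succ_iff_derivWithin hu).2
      ⟨fun x hx => (hderiv x hx).differentiableWithinAt, by simp, hC.congr heq⟩, fun x hx => ?_⟩
    rw [iteratedDerivWithin_succ', iteratedDerivWithin_succ', iteratedDerivWithin_congr heq hx,
      hI x hx, Nat.add_right_comm, Nat.add_assoc]
end
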